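/- arXiv:1606.06157 — 2 statements merged into one kernel-verified Lean document; each statement's English description precedes it below -/
import Mathlib

section
/- Let α ∈ (0,1], η, τ > 0, and let σ: [0,1] → ℝ be continuous. Let (ε_m) be defined by ε₀ = (1/η^α) I^α σ and ε_m = (1/η^α) I^α σ − (1/τ^α) I^α ε_{m−1}, where I^α z(t) = (1/Γ(α)) ∫₀ᵗ (t−s)^{α−1} z(s) ds. Then the sequence ε_m converges uniformly on [0,1], as m → ∞, to the function ε(t) = (1/η^α) ∫₀ᵗ (t−s)^{α−1} E_{α,α}(−((t−s)/τ)^α) σ(s) ds. -/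
/-- The generalized Mittag-Leffler function `E_{a,b}(t) = ∑_{n=0}^∞ tⁿ/Γ(a n + b)`. -/
noncomputable def mittagLeffler (a b t : ℝ) : ℝ := ∑' n : ℕ, t ^ n / Real.Gamma (a * n + b)

/-- The Riemann–Liouville fractional integral
`I^γ z(t) = (1/Γ(γ)) ∫₀ᵗ (t−s)^{γ−1} z(s) ds`. -/
noncomputable def fracInt (γ : ℝ) (z : ℝ → ℝ) (t : ℝ) : ℝ :=
  (1 / Real.Gamma γ) * ∫ s in (0:ℝ)..t, (t - s) ^ (γ - 1) * z s

open MeasureTheory Set Filter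
open ContinuousLinearMap (mul)
open scoped Convolution

/-- The kernel `u ↦ u^{γ-1}/Γ(γ)` of the fractional integral, truncated to `(0,1]`. -/
noncomputable def fracKernel (γ : ℝ) : ℝ → ℝ :=
  (Ioc (0:ℝ) 1).indicator fun u => u ^ (γ - 1) / Real.Gamma γ

lemma integrable_fracKernel {γ : ℝ} (hγ : 0 < γ) : Integrable (fracKernel γ) := by
  rw [fracKernel, integrable_indicator_iff measurableSet_Ioc,
    ← intervalIntegrable_iff_integrableOn_Ioc_of_le zero_le_one]
  exact (intervalIntegral.intervalIntegrable_rpow' (by linarith)).div_const _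

lemma fracInt_congr (γ : ℝ) {z w : ℝ → ℝ} {t : ℝ} (ht : t ∈ Icc (0:ℝ) 1)
    (h : ∀ s ∈ Icc (0:ℝ) 1, z s = w s) : fracInt γ z t = fracInt γ w t := by
  unfold fracInt
  congr 1
  refine intervalIntegral.integral_congr fun s hs => ?_
  rw [uIcc_of_le ht.1] at hs
  rw [h s ⟨hs.1, hs.2.trans ht.2⟩]

lemma convolution_fracKernel_indicator (γ : ℝ) (z : ℝ → ℝ) {t : ℝ} (ht : t ≤ 1) :
    (fracKernel γ ⋆[mul ℝ ℝ] (Ioc (0:ℝ) 1).indicator z) t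
      = (Ici (0:ℝ)).indicator (fracInt γ z) t := by
  simp only [convolution_eq_swap (f := fracKernel γ), ContinuousLinearMap.mul_apply']
  have key : (fun s => fracKernel γ (t - s) * (Ioc (0:ℝ) 1).indicator z s)
      = (Ioo 0 t).indicator fun s => 1 / Real.Gamma γ * ((t - s) ^ (γ - 1) * z s) := by
    ext s
    by_cases hs : s ∈ Ioo 0 t
    · have h1 : t - s ∈ Ioc (0:ℝ) 1 := ⟨by linarith [hs.2], by linarith [hs.1]⟩
      have h2 : s ∈ Ioc (0:ℝ) 1 := ⟨hs.1, by linarith [hs.2]⟩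
      rw [fracKernel, indicator_of_mem h1, indicator_of_mem h2, indicator_of_mem hs]
      ring
    · rw [indicator_of_notMem hs]
      by_cases h0 : 0 < s
      · rw [fracKernel, indicator_of_notMem, zero_mul]
        exact fun h => hs ⟨h0, by linarith [h.1]⟩
      · rw [indicator_of_notMem (fun h => h0 h.1), mul_zero]
  rw [key, integral_indicator measurableSet_Ioo, ← integral_Ioc_eq_integral_Ioo,
    integral_const_mul]
  by_cases h0 : 0 ≤ t
  · rw [indicator_of_mem (mem_Ici.2 h0), fracInt, intervalIntegral.integral_of_le h0]
  · rw [indicator_of_notMem (by simpa using h0), Ioc_eq_empty (by linarith)]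
    simp

lemma fracInt_rpow {a b u : ℝ} (ha : 0 < a) (hb : 0 < b) (hu : 0 < u) :
    fracInt a (fun s => s ^ (b - 1) / Real.Gamma b) u
      = u ^ (a + b - 1) / Real.Gamma (a + b) := by
  have h : ∫ s in (0:ℝ)..u, s ^ (b - 1) * (u - s) ^ (a - 1)
      = u ^ (b + a - 1) * ProbabilityTheory.beta b a := by
    have h1 := Complex.betaIntegral_scaled b a hu
    have h2 : Complex.betaIntegral b a = (ProbabilityTheory.beta b a : ℂ) := by
      rw [Complex.betaIntegral_eq_Gamma_mul_div _ _ (by simpa) (by simpa), ProbabilityTheory.beta,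
        ← Complex.ofReal_add]
      simp only [Complex.Gamma_ofReal]
      norm_cast
    rw [h2] at h1
    apply Complex.ofReal_injective
    rw [← intervalIntegral.integral_ofReal]
    push_cast [Complex.ofReal_cpow hu.le]
    rw [← h1]
    refine intervalIntegral.integral_congr fun s hs => ?_
    rw [uIcc_of_le hu.le] at hs
    rw [Complex.ofReal_cpow hs.1, Complex.ofReal_cpow (sub_nonneg.2 hs.2)]
    push_cast
    rfl
  have hΓa := (Real.Gamma_pos_of_pos ha).ne'
  have hΓb := (Real.Gamma_pos_of_pos hb).ne'
  have h3 : ∀ s, (u - s) ^ (a - 1) * (s ^ (b - 1) / Real.Gamma b)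
      = 1 / Real.Gamma b * (s ^ (b - 1) * (u - s) ^ (a - 1)) := fun s => by ring
  simp_rw [fracInt, h3]
  rw [intervalIntegral.integral_const_mul, h, ProbabilityTheory.beta, add_comm b a]
  field_simp

lemma convolution_fracKernel_fracKernel {a b u : ℝ} (ha : 0 < a) (hb : 0 < b) (hu : u ≤ 1) :
    (fracKernel a ⋆[mul ℝ ℝ] fracKernel b) u = fracKernel (a + b) u := by
  have h := convolution_fracKernel_indicator a (fun s => s ^ (b - 1) / Real.Gamma b) hu
  change (fracKernel a ⋆[mul ℝ ℝ] fracKernel b) u = _ at h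
  rw [h]
  rcases lt_trichotomy u 0 with h0 | h0 | h0
  · rw [indicator_of_notMem (by simpa using h0), fracKernel,
      indicator_of_notMem (fun h => by linarith [h.1])]
  · subst h0
    simp [fracInt, fracKernel]
  · rw [indicator_of_mem (mem_Ici.2 h0.le), fracInt_rpow ha hb h0, fracKernel,
      indicator_of_mem (mem_Ioc.2 ⟨h0, hu⟩)]

lemma intervalIntegrable_fracInt_integrand {γ t M : ℝ} (hγ : 0 < γ) {z : ℝ → ℝ}
    (hz : AEStronglyMeasurable z (volume.restrict (Ioc 0 1)))
    (hM : ∀ s ∈ Icc (0:ℝ) 1, |z s| ≤ M) (ht : t ∈ Icc (0:ℝ) 1) :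
    IntervalIntegrable (fun s => (t - s) ^ (γ - 1) * z s) volume 0 t := by
  have hk : IntervalIntegrable (fun s => (t - s) ^ (γ - 1)) volume 0 t := by
    have := (intervalIntegral.intervalIntegrable_rpow' (a := t) (b := 0) (r := γ - 1)
      (by linarith)).comp_sub_left t
    simpa using this
  rw [intervalIntegrable_iff_integrableOn_Ioc_of_le ht.1] at hk ⊢
  refine hk.mul_bdd (c := M) (hz.mono_set (Ioc_subset_Ioc_right ht.2)) ?_
  exact (ae_restrict_iff' measurableSet_Ioc).2 (ae_of_all _ fun s hs =>
    hM s ⟨hs.1.le, hs.2.trans ht.2⟩)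

lemma abs_fracInt_le {γ t M : ℝ} (hγ : 0 < γ) {z : ℝ → ℝ}
    (hM : ∀ s ∈ Icc (0:ℝ) 1, |z s| ≤ M) (ht : t ∈ Icc (0:ℝ) 1) :
    |fracInt γ z t| ≤ M / Real.Gamma (γ + 1) := by
  have hM0 : 0 ≤ M := (abs_nonneg _).trans (hM 0 (by simp))
  have hΓ := Real.Gamma_pos_of_pos hγ
  have hk : IntervalIntegrable (fun s => (t - s) ^ (γ - 1)) volume 0 t := by
    simpa using intervalIntegrable_fracInt_integrand hγ (z := fun _ => 1) (M := 1)
      aestronglyMeasurable_const (by simp) ht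
  have hI : ∫ s in (0:ℝ)..t, (t - s) ^ (γ - 1) = t ^ γ / γ := by
    rw [intervalIntegral.integral_comp_sub_left (fun s => s ^ (γ - 1)) t]
    simp only [sub_self, sub_zero]
    rw [integral_rpow (Or.inl (by linarith))]
    simp [hγ.ne']
  have h1 : |∫ s in (0:ℝ)..t, (t - s) ^ (γ - 1) * z s| ≤ M * (t ^ γ / γ) := by
    rw [← hI, ← intervalIntegral.integral_const_mul]
    rw [← Real.norm_eq_abs]
    refine intervalIntegral.norm_integral_le_of_norm_le ht.1 (ae_of_all _ fun s hs => ?_)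
      (hk.const_mul M)
    have h0 : 0 ≤ (t - s) ^ (γ - 1) := Real.rpow_nonneg (by linarith [hs.2]) _
    rw [Real.norm_eq_abs, abs_mul, abs_of_nonneg h0, mul_comm]
    exact mul_le_mul_of_nonneg_right (hM s ⟨hs.1.le, hs.2.trans ht.2⟩) h0
  have h2 : t ^ γ ≤ 1 := Real.rpow_le_one ht.1 ht.2 hγ.le
  rw [fracInt, abs_mul, abs_of_pos (by positivity), Real.Gamma_add_one hγ.ne']
  calc _ ≤ 1 / Real.Gamma γ * (M * (t ^ γ / γ)) := by gcongr
    _ ≤ 1 / Real.Gamma γ * (M * (1 / γ)) := by gcongr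
    _ = _ := by field_simp

lemma integrable_indicator_of_bound {M : ℝ} {z : ℝ → ℝ}
    (hz : AEStronglyMeasurable z (volume.restrict (Ioc 0 1)))
    (hM : ∀ s ∈ Icc (0:ℝ) 1, |z s| ≤ M) : Integrable ((Ioc (0:ℝ) 1).indicator z) := by
  rw [integrable_indicator_iff measurableSet_Ioc]
  exact (integrable_const M).mono' hz
    ((ae_restrict_iff' measurableSet_Ioc).2 (ae_of_all _ fun s hs => hM s ⟨hs.1.le, hs.2⟩))

lemma aestronglyMeasurable_fracInt {γ M : ℝ} (hγ : 0 < γ) {z : ℝ → ℝ}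
    (hz : AEStronglyMeasurable z (volume.restrict (Ioc 0 1)))
    (hM : ∀ s ∈ Icc (0:ℝ) 1, |z s| ≤ M) :
    AEStronglyMeasurable (fracInt γ z) (volume.restrict (Ioc 0 1)) := by
  have h := ((integrable_fracKernel hγ).integrable_convolution (mul ℝ ℝ)
    (integrable_indicator_of_bound hz hM)).aestronglyMeasurable.restrict (s := Ioc 0 1)
  refine h.congr ((ae_restrict_iff' measurableSet_Ioc).2 (ae_of_all _ fun t ht => ?_))
  exact (convolution_fracKernel_indicator γ z ht.2).trans (indicator_of_mem (mem_Ici.2 ht.1.le) _)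

/-- The semigroup property of fractional integration. -/
lemma fracInt_fracInt {a b t M : ℝ} (ha : 0 < a) (hb : 0 < b) {z : ℝ → ℝ}
    (hz : AEStronglyMeasurable z (volume.restrict (Ioc 0 1)))
    (hM : ∀ s ∈ Icc (0:ℝ) 1, |z s| ≤ M) (ht : t ∈ Icc (0:ℝ) 1) :
    fracInt a (fracInt b z) t = fracInt (a + b) z t := by
  set g := (Ioc (0:ℝ) 1).indicator z with hg
  have hgi : Integrable g := integrable_indicator_of_bound hz hM
  have hKa := integrable_fracKernel ha
  have hKb := integrable_fracKernel hb
  have hM0 : 0 ≤ M := (abs_nonneg _).trans (hM 0 (by simp))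
  have hgM : ∀ s, ‖g s‖ ≤ M := fun s => by
    rw [hg, norm_indicator_eq_indicator_norm]
    exact indicator_le' (fun s hs => hM s ⟨hs.1.le, hs.2⟩) (fun _ _ => hM0) s
  have hbdd : BddAbove ((fun i => ‖convolution (fun x => ‖fracKernel b x‖) (fun x => ‖g x‖)
      (mul ℝ ℝ) volume i‖) '' ((fun s => t - s) ⁻¹' univ)) := by
    refine ⟨∫ x, ‖fracKernel b x‖ * M, ?_⟩
    rintro _ ⟨s, -, rfl⟩
    refine norm_integral_le_of_norm_le (hKb.norm.mul_const M) (ae_of_all _ fun x => ?_)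
    simp only [ContinuousLinearMap.mul_apply', norm_mul, norm_norm]
    exact mul_le_mul_of_nonneg_left (hgM _) (norm_nonneg _)
  have hassoc := convolution_assoc (mul ℝ ℝ) (mul ℝ ℝ)
    (mul ℝ ℝ) (mul ℝ ℝ) (x₀ := t) (μ := volume)
    (ν := volume) (fun x y z => by simp [mul_assoc]) hKa.aestronglyMeasurable
    hKb.aestronglyMeasurable hgi.aestronglyMeasurable
    (hKa.ae_convolution_exists (mul ℝ ℝ) hKb)
    (hKb.norm.ae_convolution_exists (mul ℝ ℝ) hgi.norm)
    (hbdd.convolutionExistsAt _ MeasurableSet.univ (subset_univ _) hKa.norm.integrableOn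
      (hKb.norm.integrable_convolution _ hgi.norm).aestronglyMeasurable)
  have e1 : ((fracKernel a ⋆[mul ℝ ℝ] fracKernel b) ⋆[mul ℝ ℝ] g) t = fracInt (a + b) z t := by
    rw [← indicator_of_mem (mem_Ici.2 ht.1) (fracInt (a + b) z),
      ← convolution_fracKernel_indicator _ _ ht.2]
    simp only [convolution_eq_swap (g := g), ContinuousLinearMap.mul_apply', ← hg]
    refine integral_congr_ae (ae_of_all _ fun s => ?_)
    by_cases hs : s ∈ Ioc (0:ℝ) 1
    · exact congrArg (· * g s)
        (convolution_fracKernel_fracKernel ha hb (by linarith [hs.1, ht.2]))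
    · simp [hg, indicator_of_notMem hs]
  have e2 : (fracKernel a ⋆[mul ℝ ℝ] (fracKernel b ⋆[mul ℝ ℝ] g)) t = fracInt a (fracInt b z) t := by
    rw [← indicator_of_mem (mem_Ici.2 ht.1) (fracInt a _),
      ← convolution_fracKernel_indicator _ _ ht.2]
    simp only [convolution_eq_swap (f := fracKernel a), ContinuousLinearMap.mul_apply']
    refine integral_congr_ae (ae_of_all _ fun s => ?_)
    by_cases hs : t - s ∈ Ioc (0:ℝ) 1
    · have h1 : s ≤ 1 := by linarith [hs.1, ht.2]
      refine congrArg (fracKernel a (t - s) * ·)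
        ((convolution_fracKernel_indicator b z h1).trans ?_)
      rcases lt_trichotomy s 0 with h0 | h0 | h0
      · rw [indicator_of_notMem (by simpa using h0), indicator_of_notMem fun h => by linarith [h.1]]
      · subst h0
        simp [fracInt]
      · rw [indicator_of_mem (mem_Ici.2 h0.le), indicator_of_mem (mem_Ioc.2 ⟨h0, h1⟩)]
    · simp [fracKernel, indicator_of_notMem hs]
  rw [← e1, ← e2]
  exact hassoc.symm

lemma fracInt_sum {γ t : ℝ} {ι : Type*} (s : Finset ι) (f : ι → ℝ → ℝ)
    (h : ∀ i ∈ s, IntervalIntegrable (fun x => (t - x) ^ (γ - 1) * f i x) volume 0 t) :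
    fracInt γ (fun x => ∑ i ∈ s, f i x) t = ∑ i ∈ s, fracInt γ (f i) t := by
  simp only [fracInt, Finset.mul_sum]
  rw [intervalIntegral.integral_finsetSum h, Finset.mul_sum]

lemma fracInt_const_mul (γ c t : ℝ) (z : ℝ → ℝ) :
    fracInt γ (fun x => c * z x) t = c * fracInt γ z t := by
  simp only [fracInt, mul_left_comm _ c, intervalIntegral.integral_const_mul]

lemma exp_neg_mul_rpow_le_Gamma {A y : ℝ} (hA : 0 ≤ A) (hy : 1 ≤ y) :
    Real.exp (-A) * A ^ (y - 1) ≤ Real.Gamma y := by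
  have hint := Real.GammaIntegral_convergent (s := y) (by linarith)
  rw [Real.Gamma_eq_integral (by linarith), ← integral_exp_neg_Ioi A, ← integral_mul_const]
  calc _ ≤ ∫ x in Ioi A, Real.exp (-x) * x ^ (y - 1) := by
        refine setIntegral_mono_on ((integrableOn_exp_neg_Ioi A).mul_const _)
          (hint.mono_set (Ioi_subset_Ioi hA)) measurableSet_Ioi fun x hx => ?_
        exact mul_le_mul_of_nonneg_left
          (Real.rpow_le_rpow hA (le_of_lt hx) (by linarith)) (Real.exp_pos _).le
    _ ≤ _ := by
        refine setIntegral_mono_set hint ((ae_restrict_iff' measurableSet_Ioi).2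
          (ae_of_all _ fun x hx => ?_)) (Ioi_subset_Ioi hA).eventuallyLE
        exact mul_nonneg (Real.exp_pos _).le (Real.rpow_nonneg (le_of_lt hx) _)

lemma summable_pow_div_Gamma {a b : ℝ} (ha : 0 < a) (hb : 0 < b) (x : ℝ) :
    Summable fun n : ℕ => x ^ n / Real.Gamma (a * n + b) := by
  set q : ℝ := |x| + 1
  set A : ℝ := q ^ (1 / a)
  have hq : 0 < q := by positivity
  have hA : 0 < A := by positivity
  have hAa : A ^ a = q := by rw [← Real.rpow_mul hq.le, one_div_mul_cancel ha.ne', Real.rpow_one]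
  have hgeo : Summable fun n : ℕ => (|x| / q) ^ n * (Real.exp A * A ^ (1 - b)) :=
    (summable_geometric_of_lt_one (by positivity)
      ((div_lt_one hq).2 (lt_add_one _))).mul_right _
  refine hgeo.of_norm_bounded_eventually_nat ?_
  obtain ⟨N, hN⟩ := exists_nat_ge (1 / a)
  filter_upwards [eventually_ge_atTop N] with n hn
  have h1 : 1 ≤ a * n + b := by
    have : 1 / a ≤ n := hN.trans (by exact_mod_cast hn)
    rw [div_le_iff₀' ha] at this
    linarith
  have hΓ := exp_neg_mul_rpow_le_Gamma hA.le h1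
  have hpow : A ^ (a * n + b - 1) = q ^ n * (A ^ (1 - b))⁻¹ := by
    rw [← Real.rpow_neg hA.le, ← hAa, ← Real.rpow_natCast, ← Real.rpow_mul hA.le,
      ← Real.rpow_add hA]
    ring_nf
  rw [hpow] at hΓ
  rw [norm_div, norm_pow, Real.norm_eq_abs, Real.norm_eq_abs,
    abs_of_pos (Real.Gamma_pos_of_pos (by linarith))]
  calc _ ≤ |x| ^ n / (Real.exp (-A) * (q ^ n * (A ^ (1 - b))⁻¹)) := by gcongr
    _ = _ := by
      rw [Real.exp_neg, div_pow]
      field_simp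

lemma hasSum_fracInt_eq_integral_mittagLeffler {α τ t M : ℝ} (hα : 0 < α) (hτ : 0 < τ)
    {z : ℝ → ℝ} (hz : AEStronglyMeasurable z (volume.restrict (Ioc 0 1)))
    (hM : ∀ s ∈ Icc (0:ℝ) 1, |z s| ≤ M) (ht : t ∈ Icc (0:ℝ) 1) :
    HasSum (fun n : ℕ => (-(1 / τ ^ α)) ^ n * fracInt (α * n + α) z t)
      (∫ s in (0:ℝ)..t,
        (t - s) ^ (α - 1) * mittagLeffler α α (-(((t - s) / τ) ^ α)) * z s) := by
  set c : ℝ := 1 / τ ^ α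
  have hτα : 0 < τ ^ α := Real.rpow_pos_of_pos hτ _
  have hc : 0 < c := by positivity
  have hM0 : 0 ≤ M := (abs_nonneg _).trans (hM 0 (by simp))
  have hpos : ∀ n : ℕ, 0 < α * n + α := fun n => by positivity
  have hsum := summable_pow_div_Gamma hα hα c
  have hk : IntervalIntegrable (fun s => (t - s) ^ (α - 1)) volume 0 t := by
    simpa using intervalIntegrable_fracInt_integrand hα (z := fun _ => 1) (M := 1)
      aestronglyMeasurable_const (by simp) ht
  have hI : ∀ n : ℕ, (-c) ^ n * fracInt (α * n + α) z t
      = ∫ s in (0:ℝ)..t, (-c) ^ n / Real.Gamma (α * n + α) *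
          ((t - s) ^ (α * n + α - 1) * z s) := fun n => by
    rw [fracInt, intervalIntegral.integral_const_mul]
    ring
  have hsplit : ∀ n : ℕ, ∀ s < t,
      (t - s) ^ (α * n + α - 1) = (t - s) ^ (α - 1) * ((t - s) ^ α) ^ n := fun n s hs => by
    have : 0 < t - s := sub_pos.2 hs
    rw [← Real.rpow_natCast, ← Real.rpow_mul this.le, ← Real.rpow_add this]
    ring_nf
  have hne : ∀ᵐ s : ℝ, s ≠ t := by simp [ae_iff, measure_singleton]
  simp_rw [hI]
  refine intervalIntegral.hasSum_integral_of_dominated_convergence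
    (fun n s => c ^ n / Real.Gamma (α * n + α) * ((t - s) ^ (α - 1) * M)) (fun n => ?_)
    (fun n => ?_) ?_ ?_ ?_
  · have := (intervalIntegrable_fracInt_integrand (hpos n) hz hM ht).const_mul
      ((-c) ^ n / Real.Gamma (α * n + α))
    exact this.aestronglyMeasurable_restrict_uIoc
  · filter_upwards [hne] with s hst hs
    rw [uIoc_of_le ht.1] at hs
    have hs' : s < t := lt_of_le_of_ne hs.2 hst
    have h0 : 0 < t - s := sub_pos.2 hs'
    have h1 : ((t - s) ^ α) ^ n ≤ 1 :=
      pow_le_one₀ (by positivity) (Real.rpow_le_one h0.le (by linarith [hs.1, ht.2]) hα.le)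
    have h2 := hM s ⟨hs.1.le, hs.2.trans ht.2⟩
    have hΓ := Real.Gamma_pos_of_pos (hpos n)
    rw [norm_mul, norm_div, norm_pow, norm_neg, norm_mul, hsplit n s hs', Real.norm_of_nonneg hc.le,
      Real.norm_of_nonneg hΓ.le, Real.norm_of_nonneg (by positivity), Real.norm_eq_abs]
    gcongr
    exact mul_le_of_le_one_right (by positivity) h1
  · exact ae_of_all _ fun s _ => hsum.mul_right _
  · simp_rw [tsum_mul_right]
    exact (hk.mul_const M).const_mul _
  · filter_upwards [hne] with s hst hs
    rw [uIoc_of_le ht.1] at hs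
    have hs' : s < t := lt_of_le_of_ne hs.2 hst
    have h := ((summable_pow_div_Gamma hα hα (-(((t - s) / τ) ^ α))).hasSum.mul_left
      ((t - s) ^ (α - 1))).mul_right (z s)
    refine h.congr_fun ?_
    intro n
    rw [hsplit n s hs', Real.div_rpow (sub_pos.2 hs').le hτ.le]
    simp only [c, neg_pow (_ / _), div_pow]
    ring

/-- The successive approximations `ε₀ = (1/η^α) I^α σ`,
`ε_m = (1/η^α) I^α σ − (1/τ^α) I^α ε_{m−1}` converge uniformly on `[0,1]` to
`ε(t) = (1/η^α) ∫₀ᵗ (t−s)^{α−1} E_{α,α}(−((t−s)/τ)^α) σ(s) ds`. -/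
theorem successive_approximations_tendstoUniformly
    (α η τ : ℝ) (hα : α ∈ Set.Ioc (0:ℝ) 1) (hη : 0 < η) (hτ : 0 < τ)
    (σ : ℝ → ℝ) (hσ : ContinuousOn σ (Set.Icc 0 1))
    (εseq : ℕ → ℝ → ℝ)
    (h0 : ∀ t ∈ Set.Icc (0:ℝ) 1, εseq 0 t = (1 / η ^ α) * fracInt α σ t)
    (hrec : ∀ m : ℕ, ∀ t ∈ Set.Icc (0:ℝ) 1,
      εseq (m + 1) t = (1 / η ^ α) * fracInt α σ t - (1 / τ ^ α) * fracInt α (εseq m) t)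
    (ε : ℝ → ℝ)
    (hε : ∀ t ∈ Set.Icc (0:ℝ) 1, ε t =
      (1 / η ^ α) * ∫ s in (0:ℝ)..t,
        (t - s) ^ (α - 1) * mittagLeffler α α (-(((t - s) / τ) ^ α)) * σ s) :
    TendstoUniformlyOn εseq ε Filter.atTop (Set.Icc 0 1) := by
  have hα0 := hα.1
  obtain ⟨M, hM⟩ := isCompact_Icc.exists_bound_of_continuousOn hσ
  simp only [Real.norm_eq_abs] at hM
  have hz : AEStronglyMeasurable σ (volume.restrict (Ioc 0 1)) :=
    (hσ.mono Ioc_subset_Icc_self).aestronglyMeasurable measurableSet_Ioc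
  have hpos : ∀ n : ℕ, 0 < α * n + α := fun n => by positivity
  set f : ℕ → ℝ → ℝ := fun n t =>
    1 / η ^ α * ((-(1 / τ ^ α)) ^ n * fracInt (α * n + α) σ t) with hf
  have hfi : ∀ (n : ℕ), ∀ t ∈ Icc (0:ℝ) 1,
      IntervalIntegrable (fun s => (t - s) ^ (α - 1) * f n s) volume 0 t := fun n t ht => by
    have := ((intervalIntegrable_fracInt_integrand hα0
      (aestronglyMeasurable_fracInt (hpos n) hz hM)
      (fun s hs => abs_fracInt_le (hpos n) hM hs) ht).const_mul
        (1 / η ^ α * (-(1 / τ ^ α)) ^ n))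
    refine this.congr fun s _ => ?_
    simp only [hf]
    ring
  have hfrac : ∀ (n : ℕ), ∀ t ∈ Icc (0:ℝ) 1,
      -(1 / τ ^ α) * fracInt α (f n) t = f (n + 1) t := fun n t ht => by
    simp only [hf, fracInt_const_mul]
    rw [fracInt_fracInt hα0 (hpos n) hz hM ht, pow_succ]
    push_cast
    ring_nf
  have hpartial : ∀ (m : ℕ), ∀ t ∈ Icc (0:ℝ) 1,
      εseq m t = ∑ n ∈ Finset.range (m + 1), f n t := by
    intro m
    induction m with
    | zero =>
      intro t ht
      simp [h0 t ht, hf]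
    | succ m ih =>
      intro t ht
      rw [hrec m t ht, fracInt_congr α ht ih, fracInt_sum _ _ fun n _ => hfi n t ht,
        Finset.sum_range_succ' _ (m + 1), sub_eq_add_neg, ← neg_mul, Finset.mul_sum,
        Finset.sum_congr rfl fun n _ => hfrac n t ht, add_comm]
      simp [hf]
  have hbound : ∀ (n : ℕ), ∀ t ∈ Icc (0:ℝ) 1,
      ‖f n t‖ ≤ |1 / η ^ α| * M * (|1 / τ ^ α| ^ n / Real.Gamma (α * n + (α + 1))) :=
    fun n t ht => by
      have h := abs_fracInt_le (hpos n) hM ht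
      rw [add_assoc] at h
      simp only [hf, norm_mul, norm_pow, norm_neg, Real.norm_eq_abs]
      calc _ ≤ |1 / η ^ α| * (|1 / τ ^ α| ^ n * (M / Real.Gamma (α * n + (α + 1)))) := by gcongr
        _ = _ := by ring
  have hunif := tendstoUniformlyOn_tsum_nat
    ((summable_pow_div_Gamma hα0 (by linarith : 0 < α + 1) |1 / τ ^ α|).mul_left
      (|1 / η ^ α| * M)) hbound
  have hshift : TendstoUniformlyOn (fun m t => ∑ n ∈ Finset.range (m + 1), f n t)
      (fun t => ∑' n, f n t) atTop (Icc 0 1) :=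
    fun v hv => (tendsto_add_atTop_nat 1).eventually (hunif v hv)
  refine (hshift.congr (Eventually.of_forall fun m t ht => (hpartial m t ht).symm)).congr_right
    fun t ht => ?_
  rw [hε t ht]
  exact ((hasSum_fracInt_eq_integral_mittagLeffler hα0 hτ hz hM ht).mul_left _).tsum_eq
end

section
/- Let α ∈ (0,1], let η, E > 0 and set τ = η/E. Let σ: [0,∞) → [0,∞) be continuous, convex and decreasing with σ(0) > 0, and assume σ(ε)/ε → ∞ as ε → 0⁺ and σ(ε)/ε → 0 as ε → ∞. Then there exists a continuous function ε: [0,1] → ℝ with ε(t) ≥ 0 for all t ∈ [0,1], ε not identically zero, such that ε(t) = (1/η^α) ∫₀ᵗ (t−s)^{α−1} E_{α,α}(−((t−s)/τ)^α) σ(ε(s)) ds for every t ∈ [0,1]. That is, the nonlinear fractional Voigt model η^α (^C D₀^α ε)(t) + E^α ε(t) = σ(ε(t)), ε(0) = 0, has at least one nontrivial bounded positive solution. -/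
section Volterra

open MeasureTheory Set Filter Topology

/-- The `L¹`-distance between a function on the line and its translate by `h`. -/
noncomputable def translationModulus (K : ℝ → ℝ) (h : ℝ) : ℝ := ∫ u, |K (h + u) - K u|

theorem tendsto_translationModulus {K : ℝ → ℝ} (hK : Integrable K) :
    Tendsto (translationModulus K) (𝓝 0) (𝓝 0) := by
  have hK1 : MemLp K 1 volume := memLp_one_iff_integrable.2 hK
  have : Fact ((1 : ENNReal) ≠ ⊤) := ⟨ENNReal.one_ne_top⟩
  let f : Lp ℝ 1 (volume : Measure ℝ) := hK1.toLp K
  have hc : Continuous fun h : ℝ => ‖(DomAddAct.mk h +ᵥ f) - f‖ := by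
    have : Continuous fun h : ℝ => (DomAddAct.mk h +ᵥ f) :=
      (DomAddAct.continuous_mk).vadd continuous_const
    fun_prop
  have h0 := hc.tendsto 0
  have e0 : ‖(DomAddAct.mk (0 : ℝ) +ᵥ f) - f‖ = 0 := by simp
  rw [e0] at h0
  refine h0.congr fun h => ?_
  rw [L1.norm_eq_integral_norm]
  refine integral_congr_ae ?_
  have h1 : (DomAddAct.mk h +ᵥ f) = (hK1.comp_measurePreserving
      (measurePreserving_add_left volume h)).toLp _ := rfl
  rw [h1]
  filter_upwards [Lp.coeFn_sub ((hK1.comp_measurePreserving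
      (measurePreserving_add_left volume h)).toLp _) f, MemLp.coeFn_toLp hK1,
      MemLp.coeFn_toLp (hK1.comp_measurePreserving (measurePreserving_add_left volume h))]
    with u e1 e2 e3
  rw [e1, Pi.sub_apply, e3, e2]
  rfl

theorem abs_integral_kernel_sub_le {K f : ℝ → ℝ} (hK : Integrable K) (hf : Measurable f)
    {M : ℝ} (hM : ∀ s, |f s| ≤ M) (t t' : ℝ) :
    |(∫ s, K (t - s) * f s) - ∫ s, K (t' - s) * f s| ≤ M * translationModulus K (t - t') := by
  have hi : ∀ r, Integrable fun s => K (r - s) * f s := fun r =>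
    (hK.comp_sub_left r).mul_bdd (c := M) hf.aestronglyMeasurable
      (Eventually.of_forall hM)
  have hd : Integrable fun s => |K (t - s) - K (t' - s)| :=
    ((hK.comp_sub_left t).sub (hK.comp_sub_left t')).abs
  rw [← integral_sub (hi t) (hi t')]
  have hω : translationModulus K (t - t') = ∫ s, |K (t - s) - K (t' - s)| := by
    rw [translationModulus, ← integral_sub_left_eq_self _ volume t']
    congr 1 with s
    congr 3
    ring
  rw [hω, ← integral_const_mul]
  refine (abs_integral_le_integral_abs).trans (integral_mono ((hi t).sub (hi t')).abs
    (hd.const_mul M) fun s => ?_)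
  simp only
  rw [← sub_mul, abs_mul, mul_comm]
  exact mul_le_mul_of_nonneg_right (hM s) (abs_nonneg _)

theorem continuous_integral_kernel {K f : ℝ → ℝ} (hK : Integrable K) (hf : Measurable f)
    {M : ℝ} (hM : ∀ s, |f s| ≤ M) : Continuous fun t => ∫ s, K (t - s) * f s := by
  refine continuous_iff_continuousAt.2 fun t => ?_
  rw [ContinuousAt, tendsto_iff_dist_tendsto_zero]
  have h1 : Tendsto (fun r => M * translationModulus K (r - t)) (𝓝 t) (𝓝 0) := by
    have h2 : Tendsto (fun r : ℝ => r - t) (𝓝 t) (𝓝 0) := by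
      simpa using (continuous_sub_right t).tendsto t
    simpa using ((tendsto_translationModulus hK).comp h2).const_mul M
  exact squeeze_zero (fun _ => dist_nonneg) (fun r => abs_integral_kernel_sub_le hK hf hM r t) h1

/-- The Volterra operator with convolution kernel `K` and nonlinearity `g`, acting on the delayed
function `s ↦ φ (s - δ)`. -/
noncomputable def delayedVolterra (K g : ℝ → ℝ) (δ : ℝ) (φ : ℝ → ℝ) (t : ℝ) : ℝ :=
  ∫ s, K (t - s) * (Ioi 0).indicator (fun s => g (φ (s - δ))) s

section DelayedVolterra

variable {K g : ℝ → ℝ} {M : ℝ}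

theorem measurable_indicator_delayed (hg : Continuous g) {φ : ℝ → ℝ} (hφ : Continuous φ) (δ : ℝ) :
    Measurable ((Ioi (0 : ℝ)).indicator fun s => g (φ (s - δ))) :=
  (by fun_prop : Continuous fun s => g (φ (s - δ))).measurable.indicator measurableSet_Ioi

theorem abs_indicator_delayed_le (hM : ∀ x, |g x| ≤ M) (φ : ℝ → ℝ) (δ s : ℝ) :
    |(Ioi (0 : ℝ)).indicator (fun s => g (φ (s - δ))) s| ≤ M := by
  by_cases hs : s ∈ Ioi (0 : ℝ)
  · rw [indicator_of_mem hs]; exact hM _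
  · rw [indicator_of_notMem hs, abs_zero]; exact (abs_nonneg _).trans (hM 0)

theorem continuous_delayedVolterra (hK : Integrable K) (hg : Continuous g)
    (hM : ∀ x, |g x| ≤ M) (δ : ℝ) {φ : ℝ → ℝ} (hφ : Continuous φ) :
    Continuous (delayedVolterra K g δ φ) :=
  continuous_integral_kernel hK (measurable_indicator_delayed hg hφ δ)
    (abs_indicator_delayed_le hM φ δ)

theorem delayedVolterra_of_nonpos (hK0 : ∀ u ≤ 0, K u = 0) (δ : ℝ) (φ : ℝ → ℝ) {t : ℝ}
    (ht : t ≤ 0) : delayedVolterra K g δ φ t = 0 := by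
  refine integral_eq_zero_of_ae (Eventually.of_forall fun s => ?_)
  by_cases hs : s ∈ Ioi (0 : ℝ)
  · simp [hK0 (t - s) (by linarith [mem_Ioi.1 hs])]
  · simp [indicator_of_notMem hs]

theorem exists_delayedVolterra_fixedPoint (hK : Integrable K) (hK0 : ∀ u ≤ 0, K u = 0)
    (hg : Continuous g) (hM : ∀ x, |g x| ≤ M) (n : ℕ) :
    ∃ φ : ℝ → ℝ, Continuous φ ∧
      ∀ t ≤ 1, φ t = delayedVolterra K g (1 / (n + 1 : ℝ)) φ t := by
  set δ : ℝ := 1 / (n + 1 : ℝ) with hδ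
  set T := delayedVolterra K g δ
  have hcont : ∀ j, Continuous (T^[j] fun _ => 0) := fun j => by
    induction j with
    | zero => exact continuous_const
    | succ j ih =>
      rw [Function.iterate_succ_apply']
      exact continuous_delayedVolterra hK hg hM δ ih
  have hstable : ∀ j : ℕ, ∀ t ≤ j * δ, (T^[j + 1] fun _ => 0) t = (T^[j] fun _ => 0) t := by
    intro j
    induction j with
    | zero =>
      intro t ht
      exact delayedVolterra_of_nonpos (g := g) hK0 δ (fun _ => 0) (by simpa using ht)
    | succ j ih =>
      intro t ht
      rw [Function.iterate_succ_apply' _ (j + 1), Function.iterate_succ_apply' _ j]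
      refine integral_congr_ae (Eventually.of_forall fun s => ?_)
      rcases le_or_gt (t - s) 0 with hs | hs
      · simp [hK0 _ hs]
      · have : s - δ ≤ j * δ := by push_cast at ht; linarith
        have h2 := ih _ this
        simp only [indicator]
        rw [← Function.iterate_succ_apply' T j, h2]
  refine ⟨T^[n + 1] fun _ => 0, hcont _, fun t ht => ?_⟩
  rw [← hstable (n + 1) t, Function.iterate_succ_apply' T (n + 1)]
  have : ((n + 1 : ℕ) : ℝ) * δ = 1 := by rw [hδ]; push_cast; field_simp
  rwa [this]

theorem exists_volterra_solution (hK : Integrable K) (hK0 : ∀ u ≤ 0, K u = 0)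
    (hg : Continuous g) (hM : ∀ x, |g x| ≤ M) :
    ∃ φ : ℝ → ℝ, Continuous φ ∧ ∀ t ∈ Icc (0 : ℝ) 1,
      φ t = ∫ s, K (t - s) * (Ioi 0).indicator (fun s => g (φ s)) s := by
  choose φ hφc hφ using exists_delayedVolterra_fixedPoint hK hK0 hg hM
  have hmod : ∀ n, ∀ t ≤ 1, ∀ t' ≤ 1, |φ n t - φ n t'| ≤ M * translationModulus K (t - t') := by
    intro n t ht t' ht'
    rw [hφ n t ht, hφ n t' ht']
    exact abs_integral_kernel_sub_le hK (measurable_indicator_delayed hg (hφc n) _)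
      (abs_indicator_delayed_le hM _ _) t t'
  have hφ0 : ∀ n, ∀ t ≤ 0, φ n t = 0 := fun n t ht => by
    rw [hφ n t (ht.trans zero_le_one), delayedVolterra_of_nonpos hK0 _ _ ht]
  have hω : Tendsto (fun h => M * translationModulus K h) (𝓝 0) (𝓝 0) := by
    simpa using (tendsto_translationModulus hK).const_mul M
  have hbdd : ∀ n, ∀ t, t ≤ 1 → |φ n t| ≤ M * ∫ u, |K u| := by
    intro n t ht
    rw [hφ n t ht, ← integral_sub_left_eq_self _ volume t, ← integral_const_mul]
    refine (abs_integral_le_integral_abs).trans (integral_mono_of_nonneg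
      (Eventually.of_forall fun _ => abs_nonneg _) ((hK.comp_sub_left t).abs.const_mul M)
      (Eventually.of_forall fun s => ?_))
    simp only
    rw [abs_mul, mul_comm]
    exact mul_le_mul_of_nonneg_right (abs_indicator_delayed_le hM _ _ _) (abs_nonneg _)
  let ψ : ℕ → BoundedContinuousFunction (Icc (0 : ℝ) 1) ℝ := fun n =>
    BoundedContinuousFunction.mkOfCompact ⟨fun x => φ n x, by have := hφc n; fun_prop⟩
  have hcpt : IsCompact (closure (range ψ)) := by
    refine BoundedContinuousFunction.arzela_ascoli
      (Metric.closedBall 0 (M * ∫ u, |K u|)) (isCompact_closedBall _ _) _ ?_ ?_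
    · rintro _ x ⟨n, rfl⟩
      exact mem_closedBall_zero_iff.2 (hbdd n x x.2.2)
    · refine fun x => Metric.equicontinuousAt_of_continuity_modulus
        (fun y : Icc (0 : ℝ) 1 => M * translationModulus K (x - y)) ?_ _ ?_
      · refine hω.comp ?_
        have : Continuous fun y : Icc (0 : ℝ) 1 => (x : ℝ) - y := by fun_prop
        simpa using this.tendsto x
      · refine Eventually.of_forall ?_
        rintro y ⟨_, n, rfl⟩
        exact hmod n x x.2.2 y y.2.2
  obtain ⟨Φ, -, k, hk, hlim⟩ := hcpt.tendsto_subseq fun n => subset_closure (mem_range_self n)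
  have hpt : ∀ x : Icc (0 : ℝ) 1, Tendsto (fun j => φ (k j) x) atTop (𝓝 (Φ x)) := fun x =>
    ((continuous_eval_const x).tendsto Φ).comp hlim
  refine ⟨IccExtend zero_le_one Φ, Φ.continuous.Icc_extend', fun t ht => ?_⟩
  have hδ : Tendsto (fun j => 1 / ((k j : ℕ) + 1 : ℝ)) atTop (𝓝 0) :=
    tendsto_one_div_add_atTop_nhds_zero_nat.comp hk.tendsto_atTop
  have hdel : ∀ s ∈ Icc (0 : ℝ) 1, Tendsto (fun j => φ (k j) (s - 1 / ((k j : ℕ) + 1 : ℝ))) atTop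
      (𝓝 (IccExtend zero_le_one Φ s)) := by
    intro s hs
    have h1 : Tendsto (fun j => φ (k j) (s - 1 / ((k j : ℕ) + 1 : ℝ)) - φ (k j) s) atTop (𝓝 0) := by
      have h2 : Tendsto (fun j => -(1 / ((k j : ℕ) + 1 : ℝ))) atTop (𝓝 0) := by simpa using hδ.neg
      refine squeeze_zero_norm (fun j => ?_) (hω.comp h2)
      have h3 : (0 : ℝ) < 1 / ((k j : ℕ) + 1 : ℝ) := by positivity
      have := hmod (k j) (s - 1 / ((k j : ℕ) + 1 : ℝ)) (by linarith [hs.2]) s hs.2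
      rwa [sub_sub_cancel_left] at this
    have h4 := h1.add (hpt ⟨s, hs⟩)
    rw [IccExtend_of_mem _ _ hs]
    simpa using h4
  have hL : Tendsto (fun j => φ (k j) t) atTop (𝓝 (IccExtend zero_le_one Φ t)) := by
    rw [IccExtend_of_mem _ _ ht]
    exact hpt ⟨t, ht⟩
  refine tendsto_nhds_unique hL ?_
  simp_rw [fun j => hφ (k j) t ht.2]
  refine tendsto_integral_of_dominated_convergence (fun s => |K (t - s)| * M) (fun j => ?_)
    ((hK.comp_sub_left t).abs.mul_const M) (fun j => Eventually.of_forall fun s => ?_)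
    (Eventually.of_forall fun s => ?_)
  · exact (hK.comp_sub_left t).aestronglyMeasurable.mul
      (measurable_indicator_delayed hg (hφc _) _).aestronglyMeasurable
  · rw [norm_mul]
    exact mul_le_mul_of_nonneg_left (abs_indicator_delayed_le hM _ _ _) (norm_nonneg _)
  · rcases le_or_gt (t - s) 0 with hs | hs
    · simp [hK0 _ hs]
    · by_cases hs0 : s ∈ Ioi (0 : ℝ)
      · simp only [indicator_of_mem hs0]
        exact ((hg.tendsto _).comp
          (hdel s ⟨le_of_lt hs0, by linarith [ht.2]⟩)).const_mul _
      · simp [indicator_of_notMem hs0]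

end DelayedVolterra

theorem integral_sub_rpow_mul_rpow {a b t : ℝ} (ha : 0 < a) (hb : 0 < b) (ht : 0 < t) :
    ∫ s in (0 : ℝ)..t, (t - s) ^ (a - 1) * s ^ (b - 1) =
      t ^ (a + b - 1) * (Real.Gamma a * Real.Gamma b / Real.Gamma (a + b)) := by
  have h := Complex.betaIntegral_scaled b a ht
  rw [Complex.betaIntegral_eq_Gamma_mul_div _ _ (by simpa) (by simpa)] at h
  have h1 : ∫ s in (0 : ℝ)..t, (s : ℂ) ^ ((b : ℂ) - 1) * ((t : ℂ) - s) ^ ((a : ℂ) - 1) =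
      ((∫ s in (0 : ℝ)..t, (t - s) ^ (a - 1) * s ^ (b - 1) : ℝ) : ℂ) := by
    rw [← intervalIntegral.integral_ofReal]
    refine intervalIntegral.integral_congr fun s hs => ?_
    rw [uIcc_of_le ht.le] at hs
    rw [Complex.ofReal_mul, Complex.ofReal_cpow (sub_nonneg.2 hs.2), Complex.ofReal_cpow hs.1]
    push_cast
    ring
  rw [h1] at h
  apply Complex.ofReal_injective
  rw [h, Complex.ofReal_mul, Complex.ofReal_cpow ht.le, add_comm a b]
  push_cast [← Complex.Gamma_ofReal]
  rw [mul_comm (Complex.Gamma (a : ℂ))]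

theorem intervalIntegrable_sub_rpow_mul_rpow {a b t : ℝ} (ha : 0 < a) (hb : 0 < b) (ht : 0 < t) :
    IntervalIntegrable (fun s => (t - s) ^ (a - 1) * s ^ (b - 1)) volume 0 t := by
  refine not_imp_comm.1 intervalIntegral.integral_undef ?_
  rw [integral_sub_rpow_mul_rpow ha hb ht]
  have h1 := Real.Gamma_pos_of_pos ha
  have h2 := Real.Gamma_pos_of_pos hb
  have h3 := Real.Gamma_pos_of_pos (add_pos ha hb)
  positivity

theorem rpow_mul_exp_neg_le_Gamma_add_one {R x : ℝ} (hR : 0 < R) (hx : 0 < x) :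
    R ^ x * Real.exp (-R) ≤ Real.Gamma (x + 1) := by
  have hi := Real.GammaIntegral_convergent (show 0 < x + 1 by linarith)
  rw [Real.Gamma_eq_integral (by linarith), ← integral_exp_neg_Ioi R, ← integral_const_mul]
  refine (setIntegral_mono_on ((integrableOn_exp_neg_Ioi R).const_mul _)
    (hi.mono_set (Ioi_subset_Ioi hR.le)) measurableSet_Ioi fun t ht => ?_).trans
    (setIntegral_mono_set hi ?_ (Ioi_subset_Ioi hR.le).eventuallyLE)
  · rw [add_sub_cancel_right, mul_comm]
    exact mul_le_mul_of_nonneg_left (Real.rpow_le_rpow hR.le (le_of_lt ht) hx.le)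
      (Real.exp_pos _).le
  · filter_upwards [ae_restrict_mem measurableSet_Ioi] with t ht
    exact mul_nonneg (Real.exp_pos _).le (Real.rpow_nonneg (le_of_lt ht) _)

theorem inv_Gamma_le {R x : ℝ} (hR : 0 < R) (hx : 0 < x) :
    (Real.Gamma x)⁻¹ ≤ x * Real.exp R * R ^ (-x) := by
  have h := rpow_mul_exp_neg_le_Gamma_add_one hR hx
  rw [Real.Gamma_add_one hx.ne'] at h
  have hG := Real.Gamma_pos_of_pos hx
  rw [Real.rpow_neg hR.le]
  have h1 := Real.rpow_pos_of_pos hR x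
  rw [Real.exp_neg] at h
  have h2 := Real.exp_pos R
  rw [inv_le_iff_one_le_mul₀ hG]
  field_simp at h ⊢
  linarith

theorem summable_mittagLeffler {a b : ℝ} (ha : 0 < a) (hb : 0 < b) (y : ℝ) :
    Summable fun n : ℕ => y ^ n / Real.Gamma (a * n + b) := by
  set q : ℝ := 2 * |y| + 1
  have hq : 0 < q := by positivity
  set R : ℝ := q ^ (1 / a)
  have hR : 0 < R := Real.rpow_pos_of_pos hq _
  have hRa : R ^ a = q := by rw [← Real.rpow_mul hq.le, one_div_mul_cancel ha.ne', Real.rpow_one]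
  set r : ℝ := |y| / q
  have hr0 : 0 ≤ r := by positivity
  have hr1 : ‖r‖ < 1 := by
    rw [Real.norm_of_nonneg hr0, div_lt_one hq]
    linarith [abs_nonneg y]
  have hs : Summable fun n : ℕ =>
      Real.exp R * R ^ (-b) * (a * ((n : ℝ) ^ 1 * r ^ n) + b * r ^ n) :=
    (((summable_pow_mul_geometric_of_norm_lt_one 1 hr1).mul_left a).add
      ((summable_geometric_of_norm_lt_one hr1).mul_left b)).mul_left _
  refine Summable.of_norm_bounded hs fun n => ?_
  have hx : 0 < a * n + b := by positivity
  have h := inv_Gamma_le hR hx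
  rw [norm_div, norm_pow, Real.norm_eq_abs, Real.norm_of_nonneg (Real.Gamma_pos_of_pos hx).le,
    div_eq_mul_inv]
  refine (mul_le_mul_of_nonneg_left h (by positivity)).trans (le_of_eq ?_)
  have hpow : R ^ (-(a * n + b)) = R ^ (-b) * (q ^ n)⁻¹ := by
    rw [show -(a * (n : ℝ) + b) = -b + -(a * n) by ring, Real.rpow_add hR, Real.rpow_neg hR.le (a * n),
      Real.rpow_mul hR.le, hRa, Real.rpow_natCast]
  rw [hpow, div_pow]
  field_simp

theorem continuous_mittagLeffler {a b : ℝ} (ha : 0 < a) (hb : 0 < b) :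
    Continuous (mittagLeffler a b) := by
  refine continuous_iff_continuousAt.2 fun x => ?_
  have h : ContinuousOn (mittagLeffler a b) (Metric.closedBall 0 (|x| + 1)) := by
    refine continuousOn_tsum (fun n => by fun_prop) (summable_mittagLeffler ha hb (|x| + 1))
      fun n y hy => ?_
    have hG := Real.Gamma_pos_of_pos (show 0 < a * n + b by positivity)
    rw [norm_div, norm_pow, Real.norm_of_nonneg hG.le]
    exact div_le_div_of_nonneg_right
      (pow_le_pow_left₀ (norm_nonneg _) (mem_closedBall_zero_iff.1 hy) n) hG.le
  refine h.continuousAt (Metric.closedBall_mem_nhds_of_mem ?_)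
  rw [mem_ball_zero_iff, Real.norm_eq_abs]
  linarith

theorem mittagLeffler_zero_right (a b : ℝ) : mittagLeffler a b 0 = (Real.Gamma b)⁻¹ := by
  rw [mittagLeffler, tsum_eq_single 0 fun n hn => by simp [hn]]
  simp

/-- The fundamental kernel `u ^ (α - 1) * E_{α,α}(c * u ^ α)`. -/
noncomputable def mittagLefflerKernel (α c u : ℝ) : ℝ :=
  u ^ (α - 1) * mittagLeffler α α (c * u ^ α)

theorem continuous_mittagLeffler_rpow {α : ℝ} (hα : 0 < α) (c : ℝ) :
    Continuous fun u : ℝ => mittagLeffler α α (c * u ^ α) :=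
  (continuous_mittagLeffler hα hα).comp
    (continuous_const.mul (Real.continuous_rpow_const hα.le))

theorem continuousOn_mittagLefflerKernel {α : ℝ} (hα : 0 < α) (c : ℝ) :
    ContinuousOn (mittagLefflerKernel α c) (Ioi 0) :=
  (continuousOn_id.rpow_const fun _ hx => Or.inl (ne_of_gt hx)).mul
    (continuous_mittagLeffler_rpow hα c).continuousOn

theorem intervalIntegrable_mittagLefflerKernel {α : ℝ} (hα : 0 < α) (c a b : ℝ) :
    IntervalIntegrable (mittagLefflerKernel α c) volume a b :=
  (intervalIntegral.intervalIntegrable_rpow' (by linarith)).mul_continuousOn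
    (continuous_mittagLeffler_rpow hα c).continuousOn

theorem intervalIntegrable_sub_rpow_mul_mittagLefflerKernel {α t : ℝ} (hα : 0 < α) (c : ℝ)
    (ht : 0 < t) : IntervalIntegrable
      (fun s => (t - s) ^ (α - 1) * mittagLefflerKernel α c s) volume 0 t := by
  have h := (intervalIntegrable_sub_rpow_mul_rpow hα hα ht).mul_continuousOn
    (continuous_mittagLeffler_rpow hα c).continuousOn
  simpa only [mittagLefflerKernel, mul_assoc] using h

theorem mittagLefflerKernel_eq_sub_integral {α t : ℝ} (hα : 0 < α) (c : ℝ) (ht : 0 < t) :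
    mittagLefflerKernel α c t = t ^ (α - 1) / Real.Gamma α +
      c / Real.Gamma α * ∫ s in (0 : ℝ)..t, (t - s) ^ (α - 1) * mittagLefflerKernel α c s := by
  have hGα := Real.Gamma_pos_of_pos hα
  let F : ℕ → ℝ → ℝ := fun n s =>
    c ^ n / Real.Gamma (α * n + α) * ((t - s) ^ (α - 1) * s ^ ((α * n + α) - 1))
  have hb : ∀ n : ℕ, 0 < α * n + α := fun n => by positivity
  have hFint : ∀ n, IntegrableOn (F n) (Ioc 0 t) := fun n =>
    ((intervalIntegrable_iff_integrableOn_Ioc_of_le ht.le).1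
      (intervalIntegrable_sub_rpow_mul_rpow hα (hb n) ht)).const_mul _
  have hbeta : ∀ n : ℕ, ∫ s in Ioc 0 t, (t - s) ^ (α - 1) * s ^ ((α * n + α) - 1) =
      t ^ (α * n) * t ^ (2 * α - 1) * (Real.Gamma α * Real.Gamma (α * n + α) /
        Real.Gamma (α * n + 2 * α)) := fun n => by
    rw [← intervalIntegral.integral_of_le ht.le, integral_sub_rpow_mul_rpow hα (hb n) ht,
      ← Real.rpow_add ht, show α + (α * n + α) = α * n + 2 * α by ring, add_sub_assoc]
  have hval : ∀ (d : ℝ) (n : ℕ), d ^ n / Real.Gamma (α * n + α) *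
      (∫ s in Ioc 0 t, (t - s) ^ (α - 1) * s ^ ((α * n + α) - 1)) =
      t ^ (2 * α - 1) * Real.Gamma α * ((d * t ^ α) ^ n / Real.Gamma (α * n + 2 * α)) := by
    intro d n
    have h1 := Real.Gamma_pos_of_pos (hb n)
    rw [hbeta, Real.rpow_mul ht.le, Real.rpow_natCast, mul_pow]
    field_simp
  have hFval : ∀ n, ∫ s in Ioc 0 t, F n s =
      t ^ (2 * α - 1) * Real.Gamma α * ((c * t ^ α) ^ n / Real.Gamma (α * n + 2 * α)) :=
    fun n => by rw [← hval c n, ← integral_const_mul]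
  have hFnorm : ∀ n, ∫ s in Ioc 0 t, ‖F n s‖ =
      t ^ (2 * α - 1) * Real.Gamma α * ((|c| * t ^ α) ^ n / Real.Gamma (α * n + 2 * α)) :=
    fun n => by
    rw [← hval |c| n, ← integral_const_mul]
    refine setIntegral_congr_fun measurableSet_Ioc fun s hs => ?_
    simp only [F]
    rw [norm_mul, norm_div, norm_pow, Real.norm_of_nonneg (Real.Gamma_pos_of_pos (hb n)).le,
      Real.norm_eq_abs, Real.norm_of_nonneg (mul_nonneg (Real.rpow_nonneg (sub_nonneg.2 hs.2) _)
        (Real.rpow_nonneg hs.1.le _))]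
  have hsum := hasSum_integral_of_summable_integral_norm (μ := volume.restrict (Ioc 0 t)) hFint
    (by simp_rw [hFnorm]
        exact (summable_mittagLeffler hα (by linarith : 0 < 2 * α) _).mul_left _)
  have hpt : ∫ s in Ioc 0 t, ∑' n, F n s =
      ∫ s in (0 : ℝ)..t, (t - s) ^ (α - 1) * mittagLefflerKernel α c s := by
    rw [intervalIntegral.integral_of_le ht.le]
    refine setIntegral_congr_fun measurableSet_Ioc fun s hs => ?_
    simp only [F, mittagLefflerKernel, mittagLeffler]
    rw [← tsum_mul_left, ← tsum_mul_left]
    congr 1 with n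
    rw [add_sub_assoc, Real.rpow_add hs.1, Real.rpow_mul hs.1.le, Real.rpow_natCast, mul_pow]
    ring
  rw [← hpt, ← hsum.tsum_eq]
  simp_rw [hFval]
  rw [mittagLefflerKernel, mittagLeffler, (summable_mittagLeffler hα hα _).tsum_eq_zero_add,
    mul_add, ← tsum_mul_left, ← tsum_mul_left]
  congr 1
  · simp [div_eq_mul_inv]
  · congr 1 with n
    rw [show α * ((n + 1 : ℕ) : ℝ) + α = α * n + 2 * α by push_cast; ring, pow_succ,
      show t ^ (2 * α - 1) = t ^ (α - 1) * t ^ α by rw [← Real.rpow_add ht]; congr 1; ring]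
    field_simp

theorem integral_sub_rpow {α r t : ℝ} (hα : 0 < α) :
    ∫ s in r..t, (t - s) ^ (α - 1) = (t - r) ^ α / α := by
  rw [intervalIntegral.integral_comp_sub_left (fun u => u ^ (α - 1)), sub_self,
    integral_rpow (Or.inl (by linarith)), sub_add_cancel, Real.zero_rpow hα.ne', sub_zero]

theorem intervalIntegrable_sub_rpow {α : ℝ} (hα : 0 < α) (a b t : ℝ) :
    IntervalIntegrable (fun s => (t - s) ^ (α - 1)) volume a b := by
  have h := (intervalIntegral.intervalIntegrable_rpow' (r := α - 1) (a := t - a) (b := t - b)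
    (by linarith)).comp_sub_left t
  simpa using h

theorem sub_rpow_div_le {α s t t₀ : ℝ} (hα1 : α ≤ 1) (hs : 0 ≤ s) (hst : s < t) (htt : t ≤ t₀) :
    (t₀ - s) ^ (α - 1) ≤ t₀ ^ (α - 1) / t ^ (α - 1) * (t - s) ^ (α - 1) := by
  have ht : 0 < t := hs.trans_lt hst
  have h1 : 0 < t - s := sub_pos.2 hst
  have h2 : 0 < t₀ - s := by linarith
  rw [← Real.div_rpow (ht.le.trans htt) ht.le,
    ← Real.mul_rpow (div_nonneg (ht.le.trans htt) ht.le) h1.le]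
  refine Real.rpow_le_rpow_of_nonpos (by have := ht.trans_le htt; positivity) ?_ (by linarith)
  rw [div_mul_eq_mul_div, div_le_iff₀ ht]
  nlinarith

/-- Friedman's argument: the resolvent of the kernel `u ^ (α - 1)` cannot reach a first zero,
because that kernel is log-convex. -/
theorem mittagLefflerKernel_pos_of_forall_lt {α l t₀ : ℝ} (hα : 0 < α) (hα1 : α ≤ 1) (hl : 0 < l)
    (ht₀ : 0 < t₀) (hpos : ∀ u ∈ Ioo 0 t₀, 0 < mittagLefflerKernel α (-l) u) :
    0 < mittagLefflerKernel α (-l) t₀ := by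
  set k := mittagLefflerKernel α (-l) with hk
  by_contra! hcon
  have hG := Real.Gamma_pos_of_pos hα
  set m : ℝ := l / Real.Gamma α with hm
  have hm0 : 0 < m := by positivity
  obtain ⟨δ, hδ, hδ1, hδ2⟩ : ∃ δ > 0, δ ≤ t₀ / 2 ∧ m * (δ ^ α / α) < 1 / 2 := by
    have hc : Tendsto (fun δ : ℝ => m * (δ ^ α / α)) (𝓝[>] 0) (𝓝 0) := by
      have : Continuous fun δ : ℝ => m * (δ ^ α / α) :=
        ((Real.continuous_rpow_const hα.le).div_const _).const_mul _
      simpa [Real.zero_rpow hα.ne'] using (this.tendsto 0).mono_left nhdsWithin_le_nhds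
    obtain ⟨δ, h1, h2, h3⟩ := ((hc.eventually_lt_const (by norm_num : (0 : ℝ) < 1 / 2)).and
      ((Ioc_mem_nhdsGT (half_pos ht₀) : ∀ᶠ δ in 𝓝[>] (0 : ℝ), δ ∈ Ioc 0 (t₀ / 2)))).exists
    exact ⟨δ, h2, h3, h1⟩
  have hkc : ContinuousOn k (Icc (t₀ - δ) t₀) :=
    (continuousOn_mittagLefflerKernel hα (-l)).mono fun u hu => by
      have := hu.1; rw [mem_Ioi]; linarith
  obtain ⟨t, ⟨ht1, ht2⟩, hmax⟩ := isCompact_Icc.exists_isMaxOn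
    (nonempty_Icc.2 (by linarith)) hkc
  have hkt : 0 < k t := (hpos (t₀ - δ) ⟨by linarith, by linarith⟩).trans_le
    (hmax ⟨le_rfl, by linarith⟩)
  have htlt : t < t₀ := lt_of_le_of_ne ht2 fun h => by rw [h] at hkt; linarith
  have ht : 0 < t := by linarith
  set ρ : ℝ := t₀ ^ (α - 1) / t ^ (α - 1) with hρ
  have hgt : 0 < t ^ (α - 1) := Real.rpow_pos_of_pos ht _
  have hρ2 : 1 / 2 ≤ ρ := by
    rw [hρ, ← Real.div_rpow ht₀.le ht.le]
    have h1 : (2 : ℝ) ^ (α - 1) ≤ (t₀ / t) ^ (α - 1) := by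
      refine Real.rpow_le_rpow_of_nonpos (by positivity) ?_ (by linarith)
      rw [div_le_iff₀ ht]; linarith
    refine le_trans ?_ h1
    calc (1 / 2 : ℝ) = 2 ^ (-1 : ℝ) := by rw [Real.rpow_neg_one]; norm_num
      _ ≤ 2 ^ (α - 1) := Real.rpow_le_rpow_of_exponent_le (by norm_num) (by linarith)
  have hint₀ := intervalIntegrable_sub_rpow_mul_mittagLefflerKernel hα (-l) ht₀
  have hint := intervalIntegrable_sub_rpow_mul_mittagLefflerKernel hα (-l) ht
  have hint1 : IntervalIntegrable (fun s => (t₀ - s) ^ (α - 1) * k s) volume 0 t :=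
    hint₀.mono_set (by rw [uIcc_of_le ht.le, uIcc_of_le ht₀.le]; exact Icc_subset_Icc_right ht2)
  have hint2 : IntervalIntegrable (fun s => (t₀ - s) ^ (α - 1) * k s) volume t t₀ :=
    hint₀.mono_set (by rw [uIcc_of_le ht2, uIcc_of_le ht₀.le]; exact Icc_subset_Icc_left ht.le)
  have hA : ∫ s in (0 : ℝ)..t, (t₀ - s) ^ (α - 1) * k s ≤
      ρ * ∫ s in (0 : ℝ)..t, (t - s) ^ (α - 1) * k s := by
    rw [← intervalIntegral.integral_const_mul]
    refine intervalIntegral.integral_mono_on_of_le_Ioo ht.le hint1 (hint.const_mul _) fun s hs => ?_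
    rw [← mul_assoc]
    exact mul_le_mul_of_nonneg_right (sub_rpow_div_le hα1 hs.1.le hs.2 ht2)
      (hpos s ⟨hs.1, hs.2.trans htlt⟩).le
  have hB : ∫ s in t..t₀, (t₀ - s) ^ (α - 1) * k s ≤ δ ^ α / α * k t := by
    have h1 : ∫ s in t..t₀, (t₀ - s) ^ (α - 1) * k s ≤ ∫ s in t..t₀, (t₀ - s) ^ (α - 1) * k t := by
      refine intervalIntegral.integral_mono_on ht2 hint2
        ((intervalIntegrable_sub_rpow hα _ _ _).mul_const _) fun s hs => ?_
      exact mul_le_mul_of_nonneg_left (hmax ⟨ht1.trans hs.1, hs.2⟩)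
        (Real.rpow_nonneg (sub_nonneg.2 hs.2) _)
    refine h1.trans ?_
    rw [intervalIntegral.integral_mul_const, integral_sub_rpow hα]
    exact mul_le_mul_of_nonneg_right (div_le_div_of_nonneg_right
      (Real.rpow_le_rpow (by linarith) (by linarith) hα.le) hα.le) hkt.le
  have e0 := mittagLefflerKernel_eq_sub_integral hα (-l) ht₀
  have e := mittagLefflerKernel_eq_sub_integral hα (-l) ht
  rw [← hk] at e e0
  rw [← intervalIntegral.integral_add_adjacent_intervals hint1 hint2, neg_div, ← hm] at e0
  rw [neg_div, ← hm] at e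
  have hρt : ρ * (t ^ (α - 1) / Real.Gamma α) = t₀ ^ (α - 1) / Real.Gamma α := by
    rw [hρ]; field_simp
  have hA' := mul_le_mul_of_nonneg_left hA hm0.le
  have hB' := mul_le_mul_of_nonneg_left hB hm0.le
  have hρk : ρ * k t = t₀ ^ (α - 1) / Real.Gamma α -
      m * (ρ * ∫ s in (0 : ℝ)..t, (t - s) ^ (α - 1) * k s) := by
    rw [e, ← hρt]; ring
  nlinarith [mul_le_mul_of_nonneg_right hρ2 hkt.le, mul_lt_mul_of_pos_right hδ2 hkt]

theorem mittagLefflerKernel_pos {α l t : ℝ} (hα : 0 < α) (hα1 : α ≤ 1) (hl : 0 < l)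
    (ht : 0 < t) : 0 < mittagLefflerKernel α (-l) t := by
  by_contra! hcon
  set h : ℝ → ℝ := fun u => mittagLeffler α α (-l * u ^ α) with hh
  have hc : Continuous h := continuous_mittagLeffler_rpow hα (-l)
  have hsign : ∀ u, 0 < u → (0 < mittagLefflerKernel α (-l) u ↔ 0 < h u) := fun u hu =>
    mul_pos_iff_of_pos_left (Real.rpow_pos_of_pos hu _)
  set S : Set ℝ := Ici 0 ∩ h ⁻¹' Iic 0 with hS
  have hSc : IsClosed S := isClosed_Ici.inter (isClosed_Iic.preimage hc)
  have htS : t ∈ S := ⟨ht.le, not_lt.1 fun h' => hcon.not_gt ((hsign t ht).2 h')⟩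
  have hSb : BddBelow S := ⟨0, fun _ hx => hx.1⟩
  have hmem := hSc.csInf_mem ⟨t, htS⟩ hSb
  have h0 : 0 < h 0 := by
    simp only [hh, Real.zero_rpow hα.ne', mul_zero, mittagLeffler_zero_right]
    exact inv_pos.2 (Real.Gamma_pos_of_pos hα)
  have hpos : 0 < sInf S := lt_of_le_of_ne hmem.1 fun h' => by
    have := hmem.2
    rw [← h'] at this
    exact (not_lt.2 this) h0
  refine (not_lt.2 hmem.2) ((hsign _ hpos).1 (mittagLefflerKernel_pos_of_forall_lt hα hα1 hl hpos
    fun u hu => (hsign u hu.1).2 (not_le.1 fun h' => ?_)))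
  exact (notMem_of_lt_csInf hu.2 hSb) ⟨hu.1.le, h'⟩

end Volterra

/-- Existence of a nontrivial bounded positive solution for the nonlinear fractional
Voigt model `η^α (^C D₀^α ε)(t) + E^α ε(t) = σ(ε(t))`, `ε(0) = 0`, in its Volterra
fixed point form. -/
theorem nonlinear_fractional_voigt_existence
    (α η E : ℝ) (hα : α ∈ Set.Ioc (0:ℝ) 1) (hη : 0 < η) (hE : 0 < E)
    (τ : ℝ) (hτ : τ = η / E)
    (σ : ℝ → ℝ) (hσc : ContinuousOn σ (Set.Ici 0))
    (hσ0 : ∀ u ∈ Set.Ici (0:ℝ), 0 ≤ σ u)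
    (hσconv : ConvexOn ℝ (Set.Ici 0) σ)
    (hσdec : AntitoneOn σ (Set.Ici 0))
    (hσpos : 0 < σ 0)
    (h0 : Filter.Tendsto (fun u => σ u / u) (nhdsWithin 0 (Set.Ioi 0)) Filter.atTop)
    (hinf : Filter.Tendsto (fun u => σ u / u) Filter.atTop (nhds 0)) :
    ∃ ε : ℝ → ℝ, ContinuousOn ε (Set.Icc 0 1) ∧
      (∀ t ∈ Set.Icc (0:ℝ) 1, 0 ≤ ε t) ∧
      (∃ t ∈ Set.Icc (0:ℝ) 1, ε t ≠ 0) ∧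
      ∀ t ∈ Set.Icc (0:ℝ) 1, ε t =
        (1 / η ^ α) * ∫ s in (0:ℝ)..t,
          (t - s) ^ (α - 1) * mittagLeffler α α (-(((t - s) / τ) ^ α)) * σ (ε s) := by
  obtain ⟨hα0, hα1⟩ := hα
  have hτ0 : 0 < τ := hτ ▸ div_pos hη hE
  have hητ : 0 < 1 / η ^ α := one_div_pos.2 (Real.rpow_pos_of_pos hη α)
  set l : ℝ := (τ ^ α)⁻¹ with hl
  have hl0 : 0 < l := inv_pos.2 (Real.rpow_pos_of_pos hτ0 α)
  set k := mittagLefflerKernel α (-l) with hk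
  have hkpos : ∀ u, 0 < u → 0 < k u := fun u hu => mittagLefflerKernel_pos hα0 hα1 hl0 hu
  have hk_eq : ∀ u, 0 ≤ u → u ^ (α - 1) * mittagLeffler α α (-((u / τ) ^ α)) = k u := by
    intro u hu
    rw [hk, mittagLefflerKernel, Real.div_rpow hu hτ0.le, hl]
    congr 2
    ring
  have hkint : IntervalIntegrable k MeasureTheory.volume 0 1 :=
    intervalIntegrable_mittagLefflerKernel hα0 (-l) 0 1
  set K : ℝ → ℝ := (Set.Ioc 0 1).indicator fun u => 1 / η ^ α * k u with hKdef
  set g : ℝ → ℝ := fun x => σ (max x 0) with hg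
  have hK : MeasureTheory.Integrable K :=
    (MeasureTheory.integrable_indicator_iff measurableSet_Ioc).2
      (((intervalIntegrable_iff_integrableOn_Ioc_of_le zero_le_one).1 hkint).const_mul _)
  have hK0 : ∀ u ≤ 0, K u = 0 := fun u hu =>
    Set.indicator_of_notMem (fun h => absurd h.1 (not_lt.2 hu)) _
  have hgc : Continuous g :=
    hσc.comp_continuous (by fun_prop) fun x => le_max_right x 0
  have hg0 : ∀ x, 0 ≤ g x := fun x => hσ0 _ (le_max_right x 0)
  have hgM : ∀ x, |g x| ≤ σ 0 := fun x => by
    rw [abs_of_nonneg (hg0 x)]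
    exact hσdec Set.self_mem_Ici (le_max_right x 0) (le_max_right x 0)
  obtain ⟨φ, hφc, hφ⟩ := exists_volterra_solution hK hK0 hgc hgM
  have hφ0 : ∀ t ∈ Set.Icc (0 : ℝ) 1, 0 ≤ φ t := by
    intro t ht
    rw [hφ t ht]
    refine MeasureTheory.integral_nonneg fun s => mul_nonneg ?_ ?_
    · exact Set.indicator_nonneg (fun u hu => mul_nonneg hητ.le (hkpos u hu.1).le) _
    · exact Set.indicator_nonneg (fun u _ => hg0 _) _
  have hsol : ∀ t ∈ Set.Icc (0 : ℝ) 1, φ t = (1 / η ^ α) * ∫ s in (0 : ℝ)..t,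
      (t - s) ^ (α - 1) * mittagLeffler α α (-(((t - s) / τ) ^ α)) * σ (φ s) := by
    intro t ht
    rw [hφ t ht, ← intervalIntegral.integral_const_mul, intervalIntegral.integral_of_le ht.1,
      MeasureTheory.integral_Ioc_eq_integral_Ioo,
      ← MeasureTheory.integral_indicator measurableSet_Ioo]
    congr 1 with s
    by_cases hs : s ∈ Set.Ioo 0 t
    · have hs1 : t - s ∈ Set.Ioc (0 : ℝ) 1 :=
        ⟨sub_pos.2 hs.2, by linarith [hs.1, ht.2]⟩
      rw [Set.indicator_of_mem hs, Set.indicator_of_mem (Set.mem_Ioi.2 hs.1), hKdef,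
        Set.indicator_of_mem hs1, hk_eq _ hs1.1.le, hg]
      simp only
      rw [max_eq_left (hφ0 s ⟨hs.1.le, hs.2.le.trans ht.2⟩), mul_assoc]
    · rw [Set.indicator_of_notMem hs]
      rcases le_or_gt s 0 with h | h
      · rw [Set.indicator_of_notMem (Set.notMem_Ioi.2 h), mul_zero]
      · rw [hK0 _ (sub_nonpos.2 (not_lt.1 fun h' => hs ⟨h, h'⟩)), zero_mul]
  refine ⟨φ, hφc.continuousOn, hφ0, ?_, hsol⟩
  by_contra! hzero
  have h1 := hsol 1 (Set.right_mem_Icc.2 zero_le_one)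
  rw [hzero 1 (Set.right_mem_Icc.2 zero_le_one)] at h1
  have h2 : ∫ s in (0 : ℝ)..1,
      (1 - s) ^ (α - 1) * mittagLeffler α α (-(((1 - s) / τ) ^ α)) * σ (φ s) =
      ∫ s in (0 : ℝ)..1, k (1 - s) * σ 0 := by
    refine intervalIntegral.integral_congr fun s hs => ?_
    rw [Set.uIcc_of_le zero_le_one] at hs
    rw [hk_eq _ (sub_nonneg.2 hs.2), hzero s hs]
  have h3 : 0 < ∫ s in (0 : ℝ)..1, k s :=
    intervalIntegral.intervalIntegral_pos_of_pos_on hkint (fun s hs => hkpos s hs.1) zero_lt_one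
  rw [h2, intervalIntegral.integral_mul_const, intervalIntegral.integral_comp_sub_left k, sub_self,
    sub_zero] at h1
  exact absurd h1 (mul_pos hητ (mul_pos h3 hσpos)).ne
end
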